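/- arXiv:2311.15221 — 2 statements merged into one kernel-verified Lean document; each statement's English description precedes it below -/
import Mathlib

section
/- Fix β ∈ (0, 1]. Let (d_k) be a sequence of dimensions with d_k → ∞, (n_k) sample sizes with n_k ≥ d_k and n_k/(d_k log d_k) → 0, and for each k let w_k ∈ R_loc (in dimension d_k) be a fixed point with ‖P^⊥ w_k‖ = β. Then for every M > 0, the probability that min_{u ∈ S^{d_k−1}} u^⊤ ∇²L(w_k) u ≤ −M tends to 1 as k → ∞; that is, min_{u ∈ S^{d−1}} u^⊤ ∇²L(w) u → −∞ in probability. -/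
open MeasureTheory ProbabilityTheory Real Filter

noncomputable section

/-- Euclidean inner product on `Fin d → ℝ`. -/
def dot {d : ℕ} (u v : Fin d → ℝ) : ℝ := ∑ j, u j * v j

/-- Euclidean norm on `Fin d → ℝ`. -/
def nrm {d : ℕ} (u : Fin d → ℝ) : ℝ := Real.sqrt (∑ j, (u j) ^ 2)

/-- Standard Gaussian `N(0, I_d)` on `Fin d → ℝ`. -/
def stdGaussian (d : ℕ) : Measure (Fin d → ℝ) := Measure.pi fun _ => gaussianReal 0 1

/-- Law of `n` i.i.d. draws from `N(0, I_d)`. -/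
def sample (n d : ℕ) : Measure (Fin n → Fin d → ℝ) := Measure.pi fun _ => stdGaussian d

/-- The Hessian quadratic form `u^⊤ ∇²L(w) u` of the phase retrieval loss. -/
def hessQF {n d : ℕ} (wstar w u : Fin d → ℝ) (x : Fin n → Fin d → ℝ) : ℝ :=
  (1 / n) * ∑ i, (3 * (dot w (x i)) ^ 2 - (dot wstar (x i)) ^ 2) * (dot u (x i)) ^ 2

/-- Orthogonal component `P^⊥ w = w - ⟨w, w*⟩ w*`. -/
def perpPart {d : ℕ} (wstar w : Fin d → ℝ) : Fin d → ℝ := w - dot w wstar • wstar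

/-- The local region `R_loc = {w = α w* + β w^⊥ : |α - 1| ≤ 1/3, β ∈ (0,1]}`. -/
def Rloc {d : ℕ} (wstar w : Fin d → ℝ) : Prop :=
  |dot w wstar - 1| ≤ 1 / 3 ∧ 0 < nrm (perpPart wstar w) ∧ nrm (perpPart wstar w) ≤ 1


instance instProbStd (d : ℕ) : IsProbabilityMeasure (_root_.stdGaussian d) := by
  unfold _root_.stdGaussian; infer_instance

instance instProbSample (n d : ℕ) : IsProbabilityMeasure (sample n d) := by
  unfold sample; infer_instance

lemma eval_law {d : ℕ} (j : Fin d) :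
    HasLaw (fun x : Fin d → ℝ => x j) (gaussianReal 0 1) (_root_.stdGaussian d) :=
  ⟨(measurable_pi_apply j).aemeasurable, by
    unfold _root_.stdGaussian
    exact (measurePreserving_eval (fun _ : Fin d => gaussianReal 0 1) j).map_eq⟩

lemma eval_indep (d : ℕ) :
    iIndepFun (fun (j : Fin d) (x : Fin d → ℝ) => x j) (_root_.stdGaussian d) := by
  unfold _root_.stdGaussian
  exact iIndepFun_pi (μ := fun _ : Fin d => gaussianReal 0 1) (X := fun _ x => x)
    (fun _ => aemeasurable_id)

lemma eval_gauss {d : ℕ} (j : Fin d) :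
    HasGaussianLaw (fun x : Fin d → ℝ => x j) (_root_.stdGaussian d) :=
  (eval_law j).hasGaussianLaw

lemma id_gauss (d : ℕ) :
    HasGaussianLaw (fun x : Fin d → ℝ => x) (_root_.stdGaussian d) :=
  (eval_indep d).hasGaussianLaw eval_gauss

def dotL {d : ℕ} (w : Fin d → ℝ) : (Fin d → ℝ) →L[ℝ] ℝ :=
  ∑ j, w j • ContinuousLinearMap.proj (R := ℝ) (φ := fun _ : Fin d => ℝ) j

lemma dotL_apply {d : ℕ} (w x : Fin d → ℝ) : dotL w x = dot w x := by
  simp [dotL, dot]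

lemma dot_meas {d : ℕ} (w : Fin d → ℝ) : Measurable (fun x => dot w x) := by
  unfold dot; fun_prop

lemma pair_gauss {d : ℕ} (a b : Fin d → ℝ) :
    HasGaussianLaw (fun x : Fin d → ℝ => (dot a x, dot b x)) (_root_.stdGaussian d) := by
  have := (id_gauss d).map_fun ((dotL a).prod (dotL b))
  simpa [dotL_apply] using this

lemma eval_cov {d : ℕ} (i j : Fin d) :
    cov[fun x : Fin d → ℝ => x i, fun x => x j; _root_.stdGaussian d] = if i = j then 1 else 0 := by
  split_ifs with h
  · subst h
    rw [covariance_self (measurable_pi_apply i).aemeasurable, (eval_law i).variance_eq]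
    simp
  · exact ((eval_indep d).indepFun h).covariance_eq_zero (eval_gauss i).memLp_two
      (eval_gauss j).memLp_two

lemma dot_cov {d : ℕ} (a b : Fin d → ℝ) :
    cov[fun x => dot a x, fun x => dot b x; _root_.stdGaussian d] = dot a b := by
  unfold dot
  rw [covariance_fun_sum_fun_sum]
  · simp_rw [covariance_const_mul_left, covariance_const_mul_right, eval_cov]
    simp
  · exact fun i => (eval_gauss i).memLp_two.const_mul _
  · exact fun i => (eval_gauss i).memLp_two.const_mul _

lemma dot_mean {d : ℕ} (a : Fin d → ℝ) : ∫ x, dot a x ∂(_root_.stdGaussian d) = 0 := by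
  unfold dot
  rw [integral_finsetSum _ fun i _ => (eval_gauss i).integrable.const_mul _]
  refine Finset.sum_eq_zero fun i _ => ?_
  rw [integral_const_mul, (eval_law i).integral_eq]
  simp

lemma dot_law {d : ℕ} (a : Fin d → ℝ) :
    HasLaw (fun x => dot a x) (gaussianReal 0 (dot a a).toNNReal) (_root_.stdGaussian d) := by
  refine ⟨(dot_meas a).aemeasurable, ?_⟩
  have h := (pair_gauss a a).fst.map_eq_gaussianReal
  rw [h, dot_mean, ← covariance_self (dot_meas a).aemeasurable, dot_cov]

lemma dot_law_unit {d : ℕ} (a : Fin d → ℝ) (h : dot a a = 1) :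
    HasLaw (fun x => dot a x) (gaussianReal 0 1) (_root_.stdGaussian d) := by
  simpa [h] using dot_law a

lemma pair_prob {d : ℕ} (a b : Fin d → ℝ) (ha : dot a a = 1) (hb : dot b b = 1)
    (hab : dot a b = 0) (s t : Set ℝ) (hs : MeasurableSet s) (ht : MeasurableSet t) :
    (_root_.stdGaussian d).real {x | dot a x ∈ s ∧ dot b x ∈ t} =
      (gaussianReal 0 1).real s * (gaussianReal 0 1).real t := by
  have hind : IndepFun (fun x => dot a x) (fun x => dot b x) (_root_.stdGaussian d) :=
    (pair_gauss a b).indepFun_of_covariance_eq_zero (by rw [dot_cov, hab])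
  have h1 := hind.measure_inter_preimage_eq_mul s t hs ht
  have ea : (gaussianReal 0 1) s = _root_.stdGaussian d ((fun x => dot a x) ⁻¹' s) := by
    rw [← (dot_law_unit a ha).map_eq, Measure.map_apply (dot_meas a) hs]
  have eb : (gaussianReal 0 1) t = _root_.stdGaussian d ((fun x => dot b x) ⁻¹' t) := by
    rw [← (dot_law_unit b hb).map_eq, Measure.map_apply (dot_meas b) ht]
  simp only [measureReal_def]
  rw [ea, eb, ← ENNReal.toReal_mul, ← h1]
  rfl

lemma gauss_interval (c : ℝ) :
    (√(2 * π))⁻¹ * exp (-1) * exp (-c ^ 2) ≤ (gaussianReal 0 1).real (Set.Icc c (c + 1)) := by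
  have hI : ENNReal.ofReal ((√(2 * π))⁻¹ * exp (-1) * exp (-c ^ 2)) ≤
      gaussianReal 0 1 (Set.Icc c (c + 1)) := by
    rw [gaussianReal_apply 0 one_ne_zero]
    calc ENNReal.ofReal ((√(2 * π))⁻¹ * exp (-1) * exp (-c ^ 2))
        = ∫⁻ x in Set.Icc c (c + 1), ENNReal.ofReal ((√(2 * π))⁻¹ * exp (-1) * exp (-c ^ 2)) := by
          simp
      _ ≤ _ := by
          refine setLIntegral_mono' measurableSet_Icc fun x hx => ?_
          rw [gaussianPDF]
          refine ENNReal.ofReal_le_ofReal ?_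
          rw [gaussianPDFReal]
          simp only [NNReal.coe_one, mul_one, sub_zero]
          rw [mul_assoc, ← exp_add]
          refine mul_le_mul_of_nonneg_left (exp_le_exp.2 ?_) (by positivity)
          have h1 := hx.1
          have h2 := hx.2
          nlinarith [sq_nonneg (x - 2 * c)]
  rw [measureReal_def]
  exact (ENNReal.ofReal_le_iff_le_toReal (measure_ne_top _ _)).1 hI

def m4 : ℝ := ∫ z, z ^ 4 ∂(gaussianReal 0 1)

def v2 : ℝ := Var[fun z => z ^ 2; gaussianReal 0 1]

lemma m4_nonneg : 0 ≤ m4 := integral_nonneg fun z => by positivity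

lemma pow4_int : Integrable (fun z : ℝ => z ^ 4) (gaussianReal 0 1) := by
  have h := (memLp_id_gaussianReal' (μ := 0) (v := 1) 4 (by simp)).integrable_norm_pow (p := 4)
    (by norm_num)
  refine h.congr (ae_of_all _ fun z => ?_)
  simp only [id, Real.norm_eq_abs]
  exact (by decide : Even 4).pow_abs z

lemma sq_memLp : MemLp (fun z : ℝ => z ^ 2) 2 (gaussianReal 0 1) := by
  refine (memLp_two_iff_integrable_sq (by fun_prop)).2 ?_
  refine pow4_int.congr (ae_of_all _ fun z => ?_)
  simp only; ring

lemma sq_mean : ∫ z : ℝ, z ^ 2 ∂(gaussianReal 0 1) = 1 := by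
  have h := variance_fun_id_gaussianReal (μ := 0) (v := 1)
  rw [variance_of_integral_eq_zero (by fun_prop) (by simp)] at h
  simpa using h

lemma dot_self_nonneg {d : ℕ} (a : Fin d → ℝ) : 0 ≤ dot a a :=
  Finset.sum_nonneg fun i _ => mul_self_nonneg _

lemma dot_pow4 {d : ℕ} (a : Fin d → ℝ) :
    Integrable (fun x => (dot a x) ^ 4) (_root_.stdGaussian d) ∧
      ∫ x, (dot a x) ^ 4 ∂(_root_.stdGaussian d) = m4 * (dot a a) ^ 2 := by
  have hq := dot_self_nonneg a
  have hmap : (gaussianReal 0 1).map (fun z => √(dot a a) * z) =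
      (_root_.stdGaussian d).map (fun x => dot a x) := by
    rw [(dot_law a).map_eq, gaussianReal_map_const_mul]
    congr 1
    · simp
    · ext; simp [Real.sq_sqrt hq, Real.coe_toNNReal _ hq]
  have hz : ∀ z : ℝ, (√(dot a a) * z) ^ 4 = (dot a a) ^ 2 * z ^ 4 := fun z => by
    rw [mul_pow, show √(dot a a) ^ 4 = (√(dot a a) ^ 2) ^ 2 by ring, Real.sq_sqrt hq]
  have hp : AEStronglyMeasurable (fun z : ℝ => z ^ 4)
    ((_root_.stdGaussian d).map (fun x => dot a x)) := by fun_prop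
  constructor
  · have : Integrable (fun z : ℝ => z ^ 4) ((_root_.stdGaussian d).map (fun x => dot a x)) := by
      rw [← hmap, integrable_map_measure (by fun_prop) (by fun_prop)]
      simp only [Function.comp_def, hz]
      exact pow4_int.const_mul _
    exact (integrable_map_measure hp (dot_meas a).aemeasurable).1 this
  · rw [← integral_map (f := fun z : ℝ => z ^ 4) (dot_meas a).aemeasurable hp, ← hmap,
      integral_map (by fun_prop) (by fun_prop)]
    simp only [hz]
    rw [integral_const_mul, m4, mul_comm]

lemma dot_22 {d : ℕ} (w u : Fin d → ℝ) (hw : dot w w ≤ 3) (hu : dot u u ≤ 1) :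
    ∫⁻ x, ENNReal.ofReal (3 * ((dot w x) ^ 2 * (dot u x) ^ 2)) ∂(_root_.stdGaussian d)
      ≤ ENNReal.ofReal (15 * m4) := by
  obtain ⟨iw, ew⟩ := dot_pow4 w
  obtain ⟨iu, eu⟩ := dot_pow4 u
  calc _ ≤ ∫⁻ x, ENNReal.ofReal (3 / 2 * ((dot w x) ^ 4 + (dot u x) ^ 4))
        ∂(_root_.stdGaussian d) := by
        refine lintegral_mono fun x => ENNReal.ofReal_le_ofReal ?_
        nlinarith [sq_nonneg ((dot w x) ^ 2 - (dot u x) ^ 2)]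
    _ = ENNReal.ofReal (∫ x, 3 / 2 * ((dot w x) ^ 4 + (dot u x) ^ 4) ∂(_root_.stdGaussian d)) := by
        have hi : Integrable (fun x => 3 / 2 * ((dot w x) ^ 4 + (dot u x) ^ 4))
            (_root_.stdGaussian d) := (iw.add iu).const_mul _
        rw [ofReal_integral_eq_lintegral_ofReal hi (ae_of_all _ fun x => by positivity)]
    _ ≤ _ := by
        refine ENNReal.ofReal_le_ofReal ?_
        rw [integral_const_mul, integral_add iw iu, ew, eu]
        have h1 : (dot w w) ^ 2 ≤ 9 := by nlinarith [dot_self_nonneg w]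
        have h2 : (dot u u) ^ 2 ≤ 1 := by nlinarith [dot_self_nonneg u]
        nlinarith [m4_nonneg]

lemma norm_conc {d : ℕ} (hd : 0 < d) :
    (_root_.stdGaussian d).real {x | dot x x < d / 2} ≤ 4 * v2 / d := by
  have hd' : (0 : ℝ) < d := by exact_mod_cast hd
  let Y : Fin d → (Fin d → ℝ) → ℝ := fun j x => (x j) ^ 2
  have hlaw : ∀ j, HasLaw (fun x : Fin d → ℝ => x j) (gaussianReal 0 1) (_root_.stdGaussian d) :=
    eval_law
  have hY : ∀ j, MemLp (Y j) 2 (_root_.stdGaussian d) := fun j => by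
    have := sq_memLp
    rw [← (hlaw j).map_eq] at this
    exact (memLp_map_measure_iff (f := fun x : Fin d → ℝ => x j) (g := fun z : ℝ => z ^ 2)
      (by fun_prop) (measurable_pi_apply j).aemeasurable).1 this
  have hYm : ∀ j, ∫ x, Y j x ∂(_root_.stdGaussian d) = 1 := fun j => by
    rw [← sq_mean, ← (hlaw j).map_eq,
      integral_map (measurable_pi_apply j).aemeasurable (by fun_prop)]
  have hYv : ∀ j, Var[Y j; _root_.stdGaussian d] = v2 := fun j => by
    rw [v2, ← (hlaw j).map_eq,
      variance_map (X := fun z : ℝ => z ^ 2) (Y := fun x : Fin d → ℝ => x j)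
        (by fun_prop) (measurable_pi_apply j).aemeasurable]
    rfl
  have hind : Set.Pairwise (↑(Finset.univ : Finset (Fin d)))
      fun i j => IndepFun (Y i) (Y j) (_root_.stdGaussian d) := fun i _ j _ hij =>
    ((eval_indep d).indepFun hij).comp (φ := fun z : ℝ => z ^ 2) (ψ := fun z : ℝ => z ^ 2)
      (by fun_prop) (by fun_prop)
  have hv : Var[∑ j, Y j; _root_.stdGaussian d] = d * v2 := by
    rw [IndepFun.variance_sum (fun j _ => hY j) hind]
    simp [hYv]
  have hm : ∫ x, (∑ j, Y j) x ∂(_root_.stdGaussian d) = d := by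
    simp only [Finset.sum_apply]
    rw [integral_finsetSum _ fun j _ => (hY j).integrable (by norm_num)]
    simp [hYm]
  have hL : MemLp (∑ j, Y j) 2 (_root_.stdGaussian d) := memLp_finsetSum' _ fun j _ => hY j
  have hc := meas_ge_le_variance_div_sq hL (c := d / 2) (by positivity)
  rw [hv, hm] at hc
  have hsub : {x : Fin d → ℝ | dot x x < d / 2} ⊆ {x | (d : ℝ) / 2 ≤ |(∑ j, Y j) x - d|} := by
    intro x hx
    have : (∑ j, Y j) x = dot x x := by
      simp only [Finset.sum_apply, dot, Y]
      exact Finset.sum_congr rfl fun j _ => by ring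
    simp only [Set.mem_ofPred_eq, this] at hx ⊢
    rw [abs_sub_comm]
    exact le_trans (by linarith) (le_abs_self _)
  have h2 := (measure_mono hsub).trans hc
  have hv0 : 0 ≤ v2 := variance_nonneg _ _
  rw [measureReal_def]
  refine (ENNReal.toReal_le_of_le_ofReal (by positivity) h2).trans (le_of_eq ?_)
  field_simp
  ring

lemma dot_add_left' {d : ℕ} (a b x : Fin d → ℝ) (p q : ℝ) :
    dot (p • a + q • b) x = p * dot a x + q * dot b x := by
  simp only [dot, Finset.mul_sum, ← Finset.sum_add_distrib]
  exact Finset.sum_congr rfl fun j _ => by simp; ring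

lemma dot_comm' {d : ℕ} (a b : Fin d → ℝ) : dot a b = dot b a := by
  simp only [dot]
  exact Finset.sum_congr rfl fun j _ => by ring

lemma nrm_sq {d : ℕ} (a : Fin d → ℝ) : nrm a ^ 2 = dot a a := by
  rw [nrm, Real.sq_sqrt (Finset.sum_nonneg fun i _ => sq_nonneg _), dot]
  exact Finset.sum_congr rfl fun j _ => by ring

lemma nrm_eq {d : ℕ} (a : Fin d → ℝ) : nrm a = √(dot a a) := by
  rw [← nrm_sq, Real.sqrt_sq (show 0 ≤ nrm a from Real.sqrt_nonneg _)]

/-- decomposition of `w` -/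
lemma decomp {d : ℕ} (β : ℝ) (hβ : 0 < β) (hβ1 : β ≤ 1) (ws w : Fin d → ℝ) (h1 : nrm ws = 1)
    (hl : Rloc ws w) (hb : nrm (perpPart ws w) = β) :
    ∃ (α : ℝ) (v : Fin d → ℝ), 2 / 3 ≤ α ∧ α ≤ 4 / 3 ∧ dot ws ws = 1 ∧ dot v v = 1 ∧ dot ws v = 0 ∧
      (∀ x, dot w x = α * dot ws x + β * dot v x) ∧ dot w w ≤ 3 := by
  have hss : dot ws ws = 1 := by rw [← nrm_sq, h1]; norm_num
  have hp : perpPart ws w = (1 : ℝ) • w + (-dot w ws) • ws := by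
    simp [perpPart, sub_eq_add_neg]
  have hpp : dot (perpPart ws w) (perpPart ws w) = β ^ 2 := by rw [← nrm_sq, hb]
  have hsp : dot ws (perpPart ws w) = 0 := by
    rw [dot_comm', hp, dot_add_left', hss]; ring
  let v : Fin d → ℝ := β⁻¹ • perpPart ws w + (0 : ℝ) • ws
  have hvx : ∀ x, dot v x = β⁻¹ * dot (perpPart ws w) x := fun x => by
    simp only [v]; rw [dot_add_left']; ring
  have hpx : ∀ x, dot (perpPart ws w) x = dot w x - dot w ws * dot ws x := fun x => by
    rw [hp, dot_add_left']; ring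
  have hwx : ∀ x, dot w x = dot w ws * dot ws x + β * dot v x := fun x => by
    rw [hvx, hpx]; field_simp; ring
  have hα := abs_le.1 hl.1
  have hvv : dot v v = 1 := by
    rw [hvx, dot_comm', hvx, hpp]; field_simp
  have hsv : dot ws v = 0 := by rw [dot_comm', hvx, dot_comm', hsp, mul_zero]
  refine ⟨dot w ws, v, by linarith, by linarith, hss, hvv, hsv, hwx, ?_⟩
  have hvw : dot v w = β := by
    rw [dot_comm', hwx, hsv, hvv]; ring
  rw [hwx, hvw, dot_comm' ws w]
  nlinarith

def c0 : ℝ := ((√(2 * π))⁻¹ * exp (-1)) ^ 2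

lemma c0_pos : 0 < c0 := by unfold c0; positivity

def Gset {d : ℕ} (ws w : Fin d → ℝ) (s : ℝ) : Set (Fin d → ℝ) :=
  {x | 3 * (dot w x) ^ 2 - (dot ws x) ^ 2 ≤ -(s ^ 2 / 2) ∧ (d : ℝ) / 2 ≤ dot x x}

lemma Gset_meas {d : ℕ} (ws w : Fin d → ℝ) (s : ℝ) : MeasurableSet (Gset ws w s) := by
  have h1 := dot_meas w
  have h2 := dot_meas ws
  have h3 : Measurable fun x : Fin d → ℝ => dot x x := by unfold dot; fun_prop
  have h4 : Measurable fun x : Fin d → ℝ => 3 * (dot w x) ^ 2 - (dot ws x) ^ 2 := by fun_prop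
  exact (measurableSet_le h4 measurable_const).inter
    (measurableSet_le measurable_const h3)

lemma G_prob {d : ℕ} (hd : 0 < d) (β : ℝ) (hβ : 0 < β) (hβ1 : β ≤ 1) (ws w : Fin d → ℝ)
    (h1 : nrm ws = 1) (hl : Rloc ws w) (hb : nrm (perpPart ws w) = β) (s : ℝ) (hs : 8 ≤ s) :
    c0 * exp (-((1 + 16 / (9 * β ^ 2)) * s ^ 2)) - 4 * v2 / d ≤
      (_root_.stdGaussian d).real (Gset ws w s) := by
  obtain ⟨α, v, hα1, hα2, hss, hvv, hsv, hwx, -⟩ := decomp β hβ hβ1 ws w h1 hl hb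
  set c : ℝ := -(α / β * s) with hc
  set A : Set (Fin d → ℝ) := {x | dot ws x ∈ Set.Icc s (s + 1) ∧ dot v x ∈ Set.Icc c (c + 1)}
  have hA : (_root_.stdGaussian d).real A = _ :=
    pair_prob ws v hss hvv hsv (Set.Icc s (s + 1)) (Set.Icc c (c + 1)) measurableSet_Icc
      measurableSet_Icc
  have hsub : A ⊆ Gset ws w s ∪ {x | dot x x < d / 2} := by
    rintro x ⟨⟨hx1, hx2⟩, hx3, hx4⟩
    by_cases hx : dot x x < d / 2
    · exact Or.inr hx
    refine Or.inl ⟨?_, not_lt.1 hx⟩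
    rw [hwx]
    have e : β * c = -(α * s) := by rw [hc]; field_simp
    have l1 : 0 ≤ α * dot ws x + β * dot v x := by nlinarith
    have l2 : α * dot ws x + β * dot v x ≤ 3 := by nlinarith
    nlinarith
  have h2 : (_root_.stdGaussian d).real A ≤ (_root_.stdGaussian d).real (Gset ws w s) + 4 * v2 / d :=
    (measureReal_mono hsub).trans ((measureReal_union_le _ _).trans
      (by linarith [norm_conc hd]))
  have h3 : c0 * exp (-((1 + 16 / (9 * β ^ 2)) * s ^ 2)) ≤ (_root_.stdGaussian d).real A := by
    rw [hA]
    refine le_trans ?_ (mul_le_mul (gauss_interval s) (gauss_interval c) (by positivity)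
      measureReal_nonneg)
    have : c0 * (exp (-s ^ 2) * exp (-c ^ 2)) = (√(2 * π))⁻¹ * exp (-1) * exp (-s ^ 2) *
      ((√(2 * π))⁻¹ * exp (-1) * exp (-c ^ 2)) := by unfold c0; ring
    rw [← this, ← exp_add]
    refine mul_le_mul_of_nonneg_left (exp_le_exp.2 ?_) c0_pos.le
    have hcc : c ^ 2 = α ^ 2 / β ^ 2 * s ^ 2 := by rw [hc]; ring
    have : α ^ 2 / β ^ 2 ≤ 16 / (9 * β ^ 2) := by
      rw [div_le_div_iff₀ (by positivity) (by positivity)]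
      nlinarith [sq_nonneg β, mul_nonneg (sq_nonneg β) (by nlinarith : (0:ℝ) ≤ 16 - 9 * α ^ 2)]
    rw [hcc]
    nlinarith [sq_nonneg s]
  linarith

lemma pair_lint {E : Type*} [MeasurableSpace E] (γ : Measure E) [IsProbabilityMeasure γ] (n : ℕ)
    (i j : Fin n) (hij : i ≠ j) (f : E × E → ENNReal) (hf : Measurable f) :
    ∫⁻ x, f (x i, x j) ∂(Measure.pi fun _ : Fin n => γ) = ∫⁻ a, ∫⁻ b, f (a, b) ∂γ ∂γ := by
  have hind := (iIndepFun_pi (μ := fun _ : Fin n => γ) (X := fun _ x => x)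
    (fun _ => aemeasurable_id)).indepFun hij
  have h := (indepFun_iff_map_prod_eq_prod_map_map (measurable_pi_apply i).aemeasurable
    (measurable_pi_apply j).aemeasurable).1 hind
  rw [(measurePreserving_eval (fun _ : Fin n => γ) i).map_eq,
    (measurePreserving_eval (fun _ : Fin n => γ) j).map_eq] at h
  rw [← lintegral_prod _ hf.aemeasurable, ← h, lintegral_map hf (by fun_prop)]

lemma count_conc {E : Type*} [MeasurableSpace E] (γ : Measure E) [IsProbabilityMeasure γ] (n : ℕ)
    (G : Set E) (hG : MeasurableSet G) (hnp : 0 < n * γ.real G) :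
    (Measure.pi fun _ : Fin n => γ).real
      {x | ∑ i, G.indicator (fun _ => (1 : ℝ)) (x i) ≤ n * γ.real G / 2} ≤ 4 / (n * γ.real G) := by
  set μ := (Measure.pi fun _ : Fin n => γ)
  set p := γ.real G
  let Y : Fin n → (Fin n → E) → ℝ := fun i x => G.indicator (fun _ => (1 : ℝ)) (x i)
  have hg : Measurable (G.indicator (fun _ => (1 : ℝ))) := measurable_const.indicator hG
  have hYmeas : ∀ i, Measurable (Y i) := fun i => hg.comp (measurable_pi_apply i)
  have hY01 : ∀ i x, 0 ≤ Y i x ∧ Y i x ≤ 1 := fun i x => by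
    simp only [Y, Set.indicator]; split_ifs <;> simp
  have hY : ∀ i, MemLp (Y i) 2 μ := fun i =>
    MemLp.of_bound (hYmeas i).aestronglyMeasurable 1 (ae_of_all _ fun x => by
      rw [Real.norm_eq_abs, abs_of_nonneg (hY01 i x).1]; exact (hY01 i x).2)
  have hYm : ∀ i, ∫ x, Y i x ∂μ = p := fun i => by
    have h := (measurePreserving_eval (fun _ : Fin n => γ) i).map_eq
    have h2 := integral_map (μ := μ) (φ := Function.eval i) (measurable_pi_apply i).aemeasurable
      (f := G.indicator (fun _ => (1 : ℝ))) hg.aestronglyMeasurable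
    rw [h, integral_indicator hG] at h2
    simp only [Y]
    refine h2.symm.trans ?_
    simp [p, measureReal_def]
  have hYv : ∀ i, Var[Y i; μ] ≤ p := fun i => by
    refine (variance_le_expectation_sq (hYmeas i).aestronglyMeasurable).trans ?_
    rw [← hYm i]
    refine le_of_eq (integral_congr_ae (ae_of_all _ fun x => ?_))
    simp only [Y, Set.indicator, Pi.pow_apply]; split_ifs <;> simp
  have hind : Set.Pairwise (↑(Finset.univ : Finset (Fin n)))
      fun i j => IndepFun (Y i) (Y j) μ := fun i _ j _ hij =>
    ((iIndepFun_pi (μ := fun _ : Fin n => γ) (X := fun _ x => x)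
      (fun _ => aemeasurable_id)).indepFun hij).comp hg hg
  have hv : Var[∑ j, Y j; μ] ≤ n * p := by
    rw [IndepFun.variance_sum (fun j _ => hY j) hind]
    refine (Finset.sum_le_sum fun i _ => hYv i).trans ?_
    simp
  have hm : ∫ x, (∑ j, Y j) x ∂μ = n * p := by
    simp only [Finset.sum_apply]
    rw [integral_finsetSum _ fun j _ => (hY j).integrable (by norm_num)]
    simp [hYm]
  have hL : MemLp (∑ j, Y j) 2 μ := memLp_finsetSum' _ fun j _ => hY j
  have hc := meas_ge_le_variance_div_sq hL (c := n * p / 2) (by positivity)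
  rw [hm] at hc
  have hsub : {x : Fin n → E | ∑ i, G.indicator (fun _ => (1 : ℝ)) (x i) ≤ n * p / 2} ⊆
      {x | n * p / 2 ≤ |(∑ j, Y j) x - n * p|} := by
    intro x hx
    have : (∑ j, Y j) x = ∑ i, G.indicator (fun _ => (1 : ℝ)) (x i) := by
      simp only [Finset.sum_apply, Y]
    simp only [Set.mem_ofPred_eq, this] at hx ⊢
    rw [abs_sub_comm]
    exact le_trans (by linarith) (le_abs_self _)
  have h2 := (measure_mono hsub).trans hc
  rw [measureReal_def]
  refine (ENNReal.toReal_le_of_le_ofReal (by have := variance_nonneg (∑ j, Y j) μ; positivity) h2).trans ?_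
  rw [div_le_div_iff₀ (by positivity) hnp]
  nlinarith

lemma select {E : Type*} [MeasurableSpace E] (γ : Measure E) [IsProbabilityMeasure γ] (n : ℕ)
    (G : Set E) (hG : MeasurableSet G) (hnp : 0 < n * γ.real G) (F : E → E → ℝ)
    (hF0 : ∀ a b, 0 ≤ F a b) (hF : Measurable fun z : E × E => F z.1 z.2) (C K : ℝ) (hC : 0 ≤ C)
    (hK : 0 < K) (hFC : ∀ a, ∫⁻ b, ENNReal.ofReal (F a b) ∂γ ≤ ENNReal.ofReal C) :
    1 - (4 / (n * γ.real G) + 2 * C / K) ≤ (Measure.pi fun _ : Fin n => γ).real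
      {x | ∃ i, x i ∈ G ∧ ∑ j ∈ Finset.univ.erase i, F (x i) (x j) ≤ n * K} := by
  set μ := (Measure.pi fun _ : Fin n => γ)
  set p := γ.real G with hp
  have hn0 : (0 : ℝ) < n := by
    rcases Nat.eq_zero_or_pos n with h | h
    · simp [h] at hnp
    · exact_mod_cast h
  set A := {x : Fin n → E | ∑ i, G.indicator (fun _ => (1 : ℝ)) (x i) ≤ n * p / 2}
  let S : (Fin n → E) → ENNReal := fun x =>
    ∑ i, ∑ j ∈ Finset.univ.erase i, G.indicator (fun a => ENNReal.ofReal (F a (x j))) (x i)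
  have hfm : Measurable fun z : E × E => G.indicator (fun a => ENNReal.ofReal (F a z.2)) z.1 := by
    have : (fun z : E × E => G.indicator (fun a => ENNReal.ofReal (F a z.2)) z.1) =
        (Prod.fst ⁻¹' G).indicator fun z : E × E => ENNReal.ofReal (F z.1 z.2) := by
      ext z; by_cases hz : z.1 ∈ G <;> simp [hz]
    rw [this]
    exact hF.ennreal_ofReal.indicator (measurable_fst hG)
  have hfm' : ∀ i j : Fin n, Measurable fun x : Fin n → E =>
      G.indicator (fun a => ENNReal.ofReal (F a (x j))) (x i) := fun i j =>
    hfm.comp (f := fun x : Fin n → E => (x i, x j)) ((measurable_pi_apply i).prodMk (measurable_pi_apply j))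
  have hSm : Measurable S := by
    refine Finset.measurable_sum _ fun i _ => Finset.measurable_sum _ fun j _ => hfm' i j
  have hterm : ∀ i j : Fin n, i ≠ j → ∫⁻ x, G.indicator (fun a => ENNReal.ofReal (F a (x j))) (x i) ∂μ
      ≤ ENNReal.ofReal (p * C) := fun i j hij => by
    have e := pair_lint γ n i j hij
      (fun z : E × E => G.indicator (fun a => ENNReal.ofReal (F a z.2)) z.1) hfm
    simp only at e
    rw [e]
    calc _ ≤ ∫⁻ a, G.indicator (fun _ => ENNReal.ofReal C) a ∂γ := by
          refine lintegral_mono fun a => ?_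
          by_cases ha : a ∈ G
          · simpa [ha] using hFC a
          · simp [ha]
      _ = _ := by
          rw [lintegral_indicator hG, lintegral_const, Measure.restrict_apply_univ,
            ENNReal.ofReal_mul measureReal_nonneg, measureReal_def,
            ENNReal.ofReal_toReal (measure_ne_top _ _), mul_comm]
  have hS : ∫⁻ x, S x ∂μ ≤ ENNReal.ofReal (n * n * (p * C)) := by
    simp only [S]
    rw [lintegral_finsetSum _ fun i _ => Finset.measurable_sum _ fun j _ => hfm' i j]
    calc _ ≤ ∑ i : Fin n, ∑ j : Fin n, ENNReal.ofReal (p * C) := by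
          refine Finset.sum_le_sum fun i _ => ?_
          rw [lintegral_finsetSum _ fun j _ => hfm' i j]
          refine (Finset.sum_le_sum fun j hj => hterm i j (Finset.ne_of_mem_erase hj).symm).trans ?_
          exact Finset.sum_le_sum_of_subset (Finset.erase_subset _ _)
      _ = _ := by
          rw [ENNReal.ofReal_mul (p := (n : ℝ) * n) (by positivity),
            ENNReal.ofReal_mul (p := (n : ℝ)) (by positivity)]
          simp [mul_assoc]
  set B := {x : Fin n → E | ENNReal.ofReal (n * p / 2 * (n * K)) ≤ S x}
  have hB : μ.real B ≤ 2 * C / K := by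
    have h := (mul_meas_ge_le_lintegral₀ hSm.aemeasurable (μ := μ)
      (ENNReal.ofReal (n * p / 2 * (n * K)))).trans hS
    have h2 := ENNReal.toReal_mono ENNReal.ofReal_ne_top h
    have hp0 : 0 ≤ p := measureReal_nonneg
    rw [ENNReal.toReal_mul, ENNReal.toReal_ofReal (by positivity),
      ENNReal.toReal_ofReal (by positivity), ← measureReal_def] at h2
    rw [le_div_iff₀ hK]
    have h3 : (n * p) * (n * (μ.real B * K)) ≤ (n * p) * (n * (2 * C)) := by linarith
    exact le_of_mul_le_mul_left (le_of_mul_le_mul_left h3 hnp) hn0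
  have hA := count_conc γ n G hG hnp
  have hsub : (A ∪ B)ᶜ ⊆
      {x | ∃ i, x i ∈ G ∧ ∑ j ∈ Finset.univ.erase i, F (x i) (x j) ≤ n * K} := by
    intro x hx
    by_contra hcon
    simp only [Set.mem_ofPred_eq, not_exists, not_and, not_le] at hcon
    apply hx
    by_cases hxA : x ∈ A
    · exact Or.inl hxA
    refine Or.inr ?_
    simp only [A, Set.mem_ofPred_eq, not_le] at hxA
    have e : S x = ENNReal.ofReal (∑ i, ∑ j ∈ Finset.univ.erase i,
        G.indicator (fun a => F a (x j)) (x i)) := by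
      simp only [S]
      have hnn : ∀ i j, 0 ≤ G.indicator (fun a => F a (x j)) (x i) := fun i j =>
        Set.indicator_nonneg (fun a _ => hF0 _ _) _
      rw [ENNReal.ofReal_sum_of_nonneg fun i _ => Finset.sum_nonneg fun j _ => hnn i j]
      refine Finset.sum_congr rfl fun i _ => ?_
      rw [ENNReal.ofReal_sum_of_nonneg fun j _ => hnn i j]
      refine Finset.sum_congr rfl fun j _ => ?_
      by_cases ha : x i ∈ G <;> simp [ha]
    show _ ≤ S x
    rw [e]
    refine ENNReal.ofReal_le_ofReal ?_
    calc n * p / 2 * (n * K) ≤ (∑ i, G.indicator (fun _ => (1 : ℝ)) (x i)) * (n * K) := by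
          gcongr
      _ = ∑ i, G.indicator (fun _ => (1 : ℝ)) (x i) * (n * K) := by rw [Finset.sum_mul]
      _ ≤ _ := by
          refine Finset.sum_le_sum fun i _ => ?_
          by_cases ha : x i ∈ G
          · simpa [ha] using (hcon i ha).le
          · simp [ha]
  have hAB : μ.real (A ∪ B) ≤ 4 / (n * p) + 2 * C / K :=
    (measureReal_union_le _ _).trans (add_le_add hA hB)
  have huniv : (1 : ℝ) ≤ μ.real (A ∪ B) + μ.real (A ∪ B)ᶜ := by
    have := measureReal_union_le (μ := μ) (A ∪ B) (A ∪ B)ᶜ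
    rwa [Set.union_compl_self, probReal_univ] at this
  have := measureReal_mono (μ := μ) hsub
  linarith

def uu {d : ℕ} (a : Fin d → ℝ) : Fin d → ℝ := (√(dot a a))⁻¹ • a

lemma dot_uu {d : ℕ} (a b : Fin d → ℝ) : dot (uu a) b = (√(dot a a))⁻¹ * dot a b := by
  have := dot_add_left' a a b (√(dot a a))⁻¹ 0
  simpa [uu] using this

lemma uu_self {d : ℕ} (a : Fin d → ℝ) (h : 0 < dot a a) : dot (uu a) (uu a) = 1 := by
  rw [dot_uu, dot_comm' a (uu a), dot_uu, ← mul_assoc, ← mul_inv, Real.mul_self_sqrt h.le,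
    inv_mul_cancel₀ h.ne']

lemma uu_le {d : ℕ} (a : Fin d → ℝ) : dot (uu a) (uu a) ≤ 1 := by
  rcases (dot_self_nonneg a).eq_or_lt with h | h
  · rw [dot_uu, ← h]; simp
  · exact (uu_self a h).le

lemma hess_bound {n d : ℕ} (hn : 0 < n) (hd : 0 < d) (ws w : Fin d → ℝ) (x : Fin n → Fin d → ℝ)
    (s K : ℝ) (i : Fin n) (hi : x i ∈ Gset ws w s)
    (hr : ∑ j ∈ Finset.univ.erase i, 3 * ((dot w (x j)) ^ 2 * (dot (uu (x i)) (x j)) ^ 2) ≤ n * K) :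
    nrm (uu (x i)) = 1 ∧ hessQF ws w (uu (x i)) x ≤ K - s ^ 2 * d / (4 * n) := by
  obtain ⟨h1, h2⟩ := hi
  have hd' : (0 : ℝ) < d := by exact_mod_cast hd
  have hn' : (0 : ℝ) < n := by exact_mod_cast hn
  have hpos : 0 < dot (x i) (x i) := by linarith
  refine ⟨by rw [nrm_eq, uu_self _ hpos, Real.sqrt_one], ?_⟩
  have e : (dot (uu (x i)) (x i)) ^ 2 = dot (x i) (x i) := by
    rw [dot_uu, mul_pow, inv_pow, Real.sq_sqrt hpos.le, sq, ← mul_assoc,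
      inv_mul_cancel₀ hpos.ne', one_mul]
  have hsum : ∑ j, (3 * (dot w (x j)) ^ 2 - (dot ws (x j)) ^ 2) * (dot (uu (x i)) (x j)) ^ 2 ≤
      n * K - s ^ 2 / 2 * (d / 2) := by
    rw [← Finset.add_sum_erase _ _ (Finset.mem_univ i), e]
    have t1 : ∑ j ∈ Finset.univ.erase i,
        (3 * (dot w (x j)) ^ 2 - (dot ws (x j)) ^ 2) * (dot (uu (x i)) (x j)) ^ 2 ≤ n * K := by
      refine le_trans (Finset.sum_le_sum fun j _ => ?_) hr
      nlinarith [mul_nonneg (sq_nonneg (dot ws (x j))) (sq_nonneg (dot (uu (x i)) (x j)))]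
    have t2 : (3 * (dot w (x i)) ^ 2 - (dot ws (x i)) ^ 2) * dot (x i) (x i) ≤
        -(s ^ 2 / 2 * (d / 2)) := by
      have a1 := mul_le_mul_of_nonneg_right h1 hpos.le
      have a2 := mul_le_mul_of_nonneg_left h2 (by positivity : 0 ≤ s ^ 2 / 2)
      linarith
    linarith
  unfold hessQF
  calc _ ≤ 1 / (n : ℝ) * (n * K - s ^ 2 / 2 * (d / 2)) :=
        mul_le_mul_of_nonneg_left hsum (by positivity)
    _ = _ := by field_simp; ring

lemma main_k {n d : ℕ} (hn : 0 < n) (hd : 0 < d) (β : ℝ) (hβ : 0 < β) (hβ1 : β ≤ 1)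
    (ws w : Fin d → ℝ) (h1 : nrm ws = 1) (hl : Rloc ws w) (hb : nrm (perpPart ws w) = β)
    (s K M : ℝ) (hK : 0 < K)
    (hnp : 0 < n * (_root_.stdGaussian d).real (Gset ws w s))
    (hM : M + K ≤ s ^ 2 * d / (4 * n)) :
    1 - (4 / (n * (_root_.stdGaussian d).real (Gset ws w s)) + 2 * (15 * m4) / K) ≤
      (sample n d {x | ∃ u : Fin d → ℝ, nrm u = 1 ∧ hessQF ws w u x ≤ -M}).toReal := by
  obtain ⟨α, v, -, -, -, -, -, -, hww⟩ := decomp β hβ hβ1 ws w h1 hl hb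
  have hmeas : Measurable fun z : (Fin d → ℝ) × (Fin d → ℝ) =>
      3 * ((dot w z.2) ^ 2 * (dot (uu z.1) z.2) ^ 2) := by
    simp only [dot_uu]
    unfold dot
    fun_prop
  have hsel := select (_root_.stdGaussian d) n (Gset ws w s) (Gset_meas ws w s) hnp
    (fun a b => 3 * ((dot w b) ^ 2 * (dot (uu a) b) ^ 2)) (fun a b => by positivity) hmeas
    (15 * m4) K (by have := m4_nonneg; positivity) hK (fun a => dot_22 w (uu a) hww (uu_le a))
  refine hsel.trans ?_
  rw [← measureReal_def]
  refine measureReal_mono ?_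
  rintro x ⟨i, hi, hr⟩
  obtain ⟨q1, q2⟩ := hess_bound hn hd ws w x s K i hi hr
  exact ⟨uu (x i), q1, by linarith⟩

/-- **Corollary 2.2**: fix `β ∈ (0,1]`.  Along sequences `d_k → ∞`, `n_k ≥ d_k`,
`n_k/(d_k log d_k) → 0`, with fixed points `w_k ∈ R_loc` having `‖P^⊥ w_k‖ = β`,
the minimal Hessian eigenvalue direction value tends to `-∞` in probability:
for every `M > 0`, `P(min_{u ∈ S^{d_k - 1}} u^⊤ ∇²L(w_k) u ≤ -M) → 1`. -/
theorem stmt1 (β : ℝ) (hβ0 : 0 < β) (hβ1 : β ≤ 1)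
    (d n : ℕ → ℕ) (wstar w : ∀ k, Fin (d k) → ℝ)
    (hwstar : ∀ k, nrm (wstar k) = 1)
    (hd : Tendsto (fun k => (d k : ℝ)) atTop atTop)
    (hnd : ∀ k, d k ≤ n k)
    (hn : Tendsto (fun k => (n k : ℝ) / ((d k : ℝ) * Real.log (d k))) atTop (nhds 0))
    (hloc : ∀ k, Rloc (wstar k) (w k))
    (hβ : ∀ k, nrm (perpPart (wstar k) (w k)) = β) :
    ∀ M : ℝ, 0 < M →
      Tendsto
        (fun k =>
          (sample (n k) (d k)
            {x | ∃ u : Fin (d k) → ℝ, nrm u = 1 ∧ hessQF (wstar k) (w k) u x ≤ -M}).toReal)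
        atTop (nhds 1) := by
  intro M hM
  rw [tendsto_order]
  refine ⟨fun a ha => ?_, fun a ha => Eventually.of_forall fun k => lt_of_le_of_lt ?_ ha⟩
  swap
  · exact measureReal_le_one (μ := sample (n k) (d k))
  set ε := 1 - a with hε
  have hε0 : 0 < ε := by linarith
  have hm := m4_nonneg
  set K : ℝ := 60 * m4 / ε + 1 with hKdef
  have hK : 0 < K := by positivity
  have hKε : 2 * (15 * m4) / K < ε / 2 := by
    rw [div_lt_iff₀ hK, hKdef]
    have : ε / 2 * (60 * m4 / ε + 1) = 30 * m4 + ε / 2 := by field_simp; ring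
    linarith
  set Γ : ℝ := 1 + 16 / (9 * β ^ 2) with hΓ
  have hΓ0 : 0 < Γ := by positivity
  have hlog : Tendsto (fun k => Real.log (d k)) atTop atTop := Real.tendsto_log_atTop.comp hd
  have hexp : Tendsto (fun k => c0 * exp (3 / 4 * Real.log (d k)) - 4 * v2) atTop atTop := by
    refine tendsto_atTop_add_const_right _ _ (Tendsto.const_mul_atTop c0_pos ?_)
    exact Real.tendsto_exp_atTop.comp (Tendsto.const_mul_atTop (by norm_num) hlog)
  have hδ : 0 < 1 / (16 * Γ * (M + K)) := by positivity
  filter_upwards [hlog.eventually_ge_atTop (64 * (4 * Γ)), hexp.eventually_gt_atTop (8 / ε),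
    hd.eventually_gt_atTop 0, hn.eventually_lt_const hδ] with k k1 k2 k3 k4
  have hdk : 0 < d k := by exact_mod_cast k3
  have hnk : 0 < n k := lt_of_lt_of_le hdk (hnd k)
  have hnk' : (0 : ℝ) < n k := by exact_mod_cast hnk
  have hlk : 0 < Real.log (d k) := lt_of_lt_of_le (by positivity) k1
  set s : ℝ := √(Real.log (d k) / (4 * Γ)) with hs
  have hs2 : s ^ 2 = Real.log (d k) / (4 * Γ) := Real.sq_sqrt (by positivity)
  have hs8 : 8 ≤ s := by
    refine Real.le_sqrt_of_sq_le ?_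
    rw [le_div_iff₀ (by positivity)]
    linarith
  have hp := G_prob hdk β hβ0 hβ1 (wstar k) (w k) (hwstar k) (hloc k) (hβ k) s hs8
  rw [← hΓ, hs2] at hp
  set p := (_root_.stdGaussian (d k)).real (Gset (wstar k) (w k) s)
  have hdp : c0 * exp (3 / 4 * Real.log (d k)) - 4 * v2 ≤ d k * p := by
    have h := mul_le_mul_of_nonneg_left hp k3.le
    refine le_trans (le_of_eq ?_) h
    have e1 : Γ * (Real.log (d k) / (4 * Γ)) = 1 / 4 * Real.log (d k) := by field_simp
    have e2 : exp (3 / 4 * Real.log (d k)) = d k * exp (-(1 / 4 * Real.log (d k))) := by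
      nth_rw 2 [← Real.exp_log k3]
      rw [← exp_add]
      congr 1; ring
    rw [e1, e2, mul_sub, mul_div_cancel₀ _ k3.ne']
    ring
  have hp0 : 0 ≤ p := measureReal_nonneg
  have hnp : 8 / ε < n k * p := by
    have : (d k : ℝ) * p ≤ n k * p :=
      mul_le_mul_of_nonneg_right (by exact_mod_cast hnd k) hp0
    linarith
  have hnp0 : 0 < n k * p := lt_trans (by positivity) hnp
  have hMK : M + K ≤ s ^ 2 * d k / (4 * n k) := by
    rw [div_lt_div_iff₀ (by positivity) (by positivity)] at k4
    rw [hs2, le_div_iff₀ (by positivity), div_mul_eq_mul_div, le_div_iff₀ (by positivity)]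
    nlinarith
  have hfin := main_k hnk hdk β hβ0 hβ1 (wstar k) (w k) (hwstar k) (hloc k) (hβ k) s K M hK hnp0 hMK
  have h4 : 4 / (n k * p) < ε / 2 := by
    rw [div_lt_iff₀ hε0] at hnp
    rw [div_lt_iff₀ hnp0]
    linarith
  refine lt_of_lt_of_le ?_ hfin
  have : 4 / (n k * p) + 2 * (15 * m4) / K < ε := by linarith
  linarith
end
end

section
/- There exist absolute constants C, c > 0 such that whenever n, d ≥ C, setting γ_{n,d} = C √((log n)/d), with probability at least 1 − C e^{−c √d} − C e^{−c log n} over the draw of x_1, …, x_n, one has min over u ∈ S^{d−1} and w ∈ R^d with ‖w − w*‖ ≤ γ_{n,d} of u^⊤ ∇²L(w) u ≤ −c (d log n)/n + C. -/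
open MeasureTheory ProbabilityTheory Real

noncomputable section

instance (d : ℕ) : IsProbabilityMeasure (stdGaussian d) := by
  unfold _root_.stdGaussian; infer_instance

instance (n d : ℕ) : IsProbabilityMeasure (sample n d) := by
  unfold sample; infer_instance

lemma measurable_dot {d : ℕ} (v : Fin d → ℝ) : Measurable (dot v) := by
  unfold dot; fun_prop

lemma sum_sq_of_nrm {d : ℕ} {v : Fin d → ℝ} (hv : nrm v = 1) : ∑ j, (v j) ^ 2 = 1 := by
  unfold nrm at hv
  rwa [Real.sqrt_eq_one] at hv

lemma map_dot {d : ℕ} {v : Fin d → ℝ} (hv : nrm v = 1) :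
    (stdGaussian d).map (dot v) = gaussianReal 0 1 := by
  have h1 : (stdGaussian d).map (fun x => fun j => v j * x j)
      = Measure.pi (fun j => (gaussianReal 0 1).map (fun z => v j * z)) := by
    unfold _root_.stdGaussian
    rw [Measure.pi_map_pi (f := fun j z => v j * z)]
    intro i; fun_prop
  have h2 : (stdGaussian d).map (dot v) =
      ((stdGaussian d).map (fun x => fun j => v j * x j)).map (fun x => ∑ j, x j) := by
    rw [Measure.map_map (by fun_prop) (by fun_prop)]
    rfl
  rw [h2, h1]
  have : ∀ j, IsProbabilityMeasure ((gaussianReal 0 1).map (fun z => v j * z)) := fun j =>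
    Measure.isProbabilityMeasure_map (by fun_prop)
  have : IsProbabilityMeasure ((Measure.pi (fun j => (gaussianReal 0 1).map (fun z => v j * z))).map (fun x => ∑ j, x j)) :=
    Measure.isProbabilityMeasure_map (by fun_prop)
  apply Measure.ext_of_charFun
  rw [charFun_map_sum_pi_eq_prod]
  ext t
  simp only [Finset.prod_apply, gaussianReal_map_const_mul, charFun_gaussianReal]
  rw [← Complex.exp_sum]
  congr 1
  have := sum_sq_of_nrm hv
  have h3 : (∑ j, ((v j : ℂ)) ^ 2) = 1 := by exact_mod_cast this
  simp
  rw [← Finset.sum_div, ← Finset.sum_mul, h3]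
  simp

lemma cheb {α : Type*} [MeasurableSpace α] (μ : Measure α) [IsProbabilityMeasure μ] (f : α → ℝ)
    (hf : MemLp f 2 μ) (k : ℕ) (hk : 0 < k) (t : ℝ) (ht : 0 < t) :
    (Measure.pi (fun _ : Fin k => μ)).real {x | k * t ≤ |∑ j, f (x j) - k * μ[f]|}
      ≤ Var[f; μ] / t ^ 2 / k := by
  have hk' : (0 : ℝ) < k := by exact_mod_cast hk
  have hm : ∀ j : Fin k, MemLp (fun x : Fin k → α => f (x j)) 2 (Measure.pi (fun _ : Fin k => μ)) :=
    fun j => hf.comp_measurePreserving (measurePreserving_eval _ j)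
  have hs : MemLp (∑ j, fun x : Fin k → α => f (x j)) 2 (Measure.pi (fun _ : Fin k => μ)) :=
    memLp_finsetSum' _ (fun j _ => hm j)
  have hv := variance_sum_pi (μ := fun _ : Fin k => μ) (X := fun _ => f) (fun _ => hf)
  have he : (Measure.pi (fun _ : Fin k => μ))[∑ j, fun x : Fin k → α => f (x j)] = (k : ℝ) * μ[f] := by
    simp only [Finset.sum_apply]
    rw [integral_finsetSum _ (fun j _ => (hm j).integrable (by norm_num))]
    have : ∀ j : Fin k, ∫ x : Fin k → α, f (x j) ∂(Measure.pi (fun _ : Fin k => μ)) = μ[f] := by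
      intro j
      exact integral_comp_eval (μ := fun _ : Fin k => μ) (i := j) hf.aestronglyMeasurable
    simp [this]
  have := meas_ge_le_variance_div_sq hs (c := k * t) (by positivity)
  rw [he, hv] at this
  have h2 := ENNReal.toReal_mono (by simp) this
  rw [ENNReal.toReal_ofReal (div_nonneg (Finset.sum_nonneg fun _ _ => variance_nonneg _ _) (by positivity))] at h2
  simp only [Finset.sum_apply] at h2
  refine h2.trans (le_of_eq ?_)
  simp
  field_simp

lemma memLp_pow (p : ℕ) : MemLp (fun z : ℝ => z ^ p) 2 (gaussianReal 0 1) := by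
  rw [memLp_two_iff_integrable_sq (by fun_prop)]
  have := (memLp_id_gaussianReal' (μ := 0) (v := 1) ((p * 2 : ℕ)) (by finiteness)).integrable_norm_pow'
  refine this.congr (Filter.Eventually.of_forall fun z => ?_)
  simp only [id, Real.norm_eq_abs, pow_mul, ← abs_pow]
  exact abs_of_nonneg (sq_nonneg _)

def mA : ℝ := ∫ z, z ^ 4 ∂(gaussianReal 0 1)
def mB : ℝ := Var[fun z : ℝ => z ^ 4; gaussianReal 0 1]
def mV : ℝ := Var[fun z : ℝ => z ^ 2; gaussianReal 0 1]

lemma fourth {d : ℕ} {v : Fin d → ℝ} (hv : nrm v = 1) (k : ℕ) (hk : 0 < k) :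
    (sample k d).real {x | (mA + 1) * k ≤ ∑ j, (dot v (x j)) ^ 4} ≤ mB / k := by
  have h := cheb (gaussianReal 0 1) (fun z => z ^ 4) (memLp_pow 4) k hk 1 one_pos
  rw [one_pow, div_one] at h
  have hmp : MeasurePreserving (fun (x : Fin k → Fin d → ℝ) j => dot v (x j)) (sample k d)
      (Measure.pi (fun _ : Fin k => gaussianReal 0 1)) := by
    unfold sample
    exact measurePreserving_pi _ _ (fun _ => ⟨measurable_dot v, map_dot hv⟩)
  rw [← hmp.measureReal_preimage] at h
  · refine (measureReal_mono ?_).trans h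
    intro x hx
    simp only [Set.mem_ofPred_eq, Set.mem_preimage] at hx ⊢
    refine le_trans ?_ (le_abs_self _)
    have : (gaussianReal 0 1)[fun z => z ^ 4] = mA := rfl
    rw [this]; linarith
  · apply MeasurableSet.nullMeasurableSet
    measurability

lemma norm_low (d : ℕ) (hd : 0 < d) :
    (stdGaussian d).real {x | ∑ j, (x j) ^ 2 ≤ d / 2} ≤ 4 * mV / d := by
  have h := cheb (gaussianReal 0 1) (fun z => z ^ 2) (memLp_pow 2) d hd (1/2) (by norm_num)
  have h1 : (gaussianReal 0 1)[fun z => z ^ 2] = 1 := by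
    have := variance_of_integral_eq_zero (μ := gaussianReal 0 1) (X := id) (by fun_prop) (by simp)
    rw [variance_id_gaussianReal] at this
    simpa using this.symm
  rw [h1] at h
  refine (measureReal_mono ?_).trans (h.trans (le_of_eq ?_))
  · intro x hx
    simp only [Set.mem_ofPred_eq] at hx ⊢
    refine le_trans ?_ (neg_le_abs _)
    linarith
  · unfold mV; ring

lemma slice_bound {k d : ℕ} (hk : 0 < k) (hd : 0 < d) (i : Fin (k+1)) :
    (sample (k+1) d).real {x | 0 < ∑ j, (x i j) ^ 2 ∧
      (mA + 1) * k * (∑ j, (x i j) ^ 2) ^ 2 ≤ ∑ j : Fin k, (dot (x i) (x (i.succAbove j))) ^ 4}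
      ≤ mB / k := by
  have hmp := measurePreserving_piFinSuccAbove (fun _ : Fin (k+1) => stdGaussian d) i
  set T : Set ((Fin d → ℝ) × (Fin k → Fin d → ℝ)) := {p | 0 < ∑ j, (p.1 j) ^ 2 ∧
      (mA + 1) * k * (∑ j, (p.1 j) ^ 2) ^ 2 ≤ ∑ j : Fin k, (dot p.1 (p.2 j)) ^ 4} with hT
  have hTm : MeasurableSet T := by
    have h1 : MeasurableSet {p : (Fin d → ℝ) × (Fin k → Fin d → ℝ) | 0 < ∑ j, (p.1 j) ^ 2} :=
      measurableSet_lt (by fun_prop) (by fun_prop)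
    have h2 : MeasurableSet {p : (Fin d → ℝ) × (Fin k → Fin d → ℝ) |
        (mA + 1) * k * (∑ j, (p.1 j) ^ 2) ^ 2 ≤ ∑ j : Fin k, (dot p.1 (p.2 j)) ^ 4} := by
      unfold dot
      apply measurableSet_le <;> fun_prop
    exact h1.inter h2
  have hpre : {x : Fin (k+1) → Fin d → ℝ | 0 < ∑ j, (x i j) ^ 2 ∧
      (mA + 1) * k * (∑ j, (x i j) ^ 2) ^ 2 ≤ ∑ j : Fin k, (dot (x i) (x (i.succAbove j))) ^ 4}
      = (MeasurableEquiv.piFinSuccAbove (fun _ => Fin d → ℝ) i) ⁻¹' T := by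
    ext x; rfl
  have hB : 0 ≤ mB / k := div_nonneg (variance_nonneg _ _) (by positivity)
  rw [hpre]
  unfold sample
  rw [hmp.measureReal_preimage hTm.nullMeasurableSet]
  refine ENNReal.toReal_le_of_le_ofReal hB ?_
  rw [Measure.prod_apply hTm]
  calc _ ≤ ∫⁻ y, ENNReal.ofReal (mB / k) ∂(stdGaussian d) := by
        apply lintegral_mono
        intro y
        dsimp only
        by_cases hy : 0 < ∑ j, (y j) ^ 2
        · set r := Real.sqrt (∑ j, (y j) ^ 2) with hr
          have hr0 : 0 < r := Real.sqrt_pos.2 hy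
          have hr2 : r ^ 2 = ∑ j, (y j) ^ 2 := Real.sq_sqrt hy.le
          have hn : nrm (fun j => y j / r) = 1 := by
            unfold nrm
            simp_rw [div_pow]
            rw [← Finset.sum_div, ← hr2, div_self (by positivity), Real.sqrt_one]
          have hf := fourth hn k hk
          rw [ENNReal.le_ofReal_iff_toReal_le (by finiteness) hB]
          refine le_trans (measureReal_mono ?_) hf
          intro z hz
          simp only [hT, Set.mem_preimage, Set.mem_ofPred_eq] at hz ⊢
          have : ∀ z : Fin d → ℝ, dot (fun j => y j / r) z = dot y z / r := by
            intro z; unfold dot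
            rw [Finset.sum_div]; congr 1; ext j; ring
          simp_rw [this, div_pow]
          rw [← Finset.sum_div, le_div_iff₀ (by positivity)]
          have := hz.2
          rw [← hr2] at this
          linarith [this]
        · have : (Prod.mk y ⁻¹' T) = ∅ := by
            ext z; simp [hT]; intro h; exact absurd h hy
          simp [this]
    _ = _ := by simp

lemma gauss_lower (a : ℝ) (ha : 1 ≤ a) :
    1 / 3 * Real.exp (-2 * a ^ 2) ≤ (gaussianReal 0 1).real (Set.Icc a (2 * a)) := by
  have h : ENNReal.ofReal (1 / 3 * Real.exp (-2 * a ^ 2)) ≤ gaussianReal 0 1 (Set.Icc a (2 * a)) := by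
    rw [gaussianReal_apply _ (by norm_num)]
    calc ENNReal.ofReal (1 / 3 * Real.exp (-2 * a ^ 2))
        ≤ ENNReal.ofReal (1 / 3 * Real.exp (-2 * a ^ 2)) * volume (Set.Icc a (2 * a)) := by
          apply le_mul_of_one_le_right (by simp)
          rw [Real.volume_Icc]
          apply ENNReal.one_le_ofReal.2; linarith
      _ = ∫⁻ x in Set.Icc a (2 * a), ENNReal.ofReal (1 / 3 * Real.exp (-2 * a ^ 2)) := by
          rw [setLIntegral_const]
      _ ≤ _ := by
          apply setLIntegral_mono (by fun_prop)
          intro x hx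
          unfold gaussianPDF gaussianPDFReal
          apply ENNReal.ofReal_le_ofReal
          have hpi : Real.sqrt (2 * Real.pi) ≤ 3 := by
            rw [Real.sqrt_le_left (by norm_num)]
            linarith [Real.pi_lt_four]
          have h0 : 0 < Real.sqrt (2 * Real.pi) := by positivity
          apply mul_le_mul
          · simp only [NNReal.coe_one, mul_one]
            rw [one_div]
            exact inv_anti₀ h0 hpi
          · apply Real.exp_le_exp.2
            simp only [NNReal.coe_one, mul_one, sub_zero]
            have := hx.1; have := hx.2
            nlinarith
          · positivity
          · positivity
  exact (ENNReal.ofReal_le_iff_le_toReal (by finiteness)).1 h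

lemma none_bound {n d : ℕ} {v : Fin d → ℝ} (hv : nrm v = 1) (S : Finset (Fin n)) (a : ℝ)
    (ha : 1 ≤ a) :
    (sample n d).real {x | ∀ i ∈ S, dot v (x i) ∉ Set.Icc a (2 * a)}
      ≤ Real.exp (- (1 / 3 * Real.exp (-2 * a ^ 2) * S.card)) := by
  classical
  set E : Set (Fin d → ℝ) := dot v ⁻¹' Set.Icc a (2 * a) with hE
  have hEm : MeasurableSet E := measurable_dot v measurableSet_Icc
  have hEp : (stdGaussian d).real E = (gaussianReal 0 1).real (Set.Icc a (2 * a)) := by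
    rw [← map_dot hv, map_measureReal_apply (measurable_dot v) measurableSet_Icc]
  have hset : {x : Fin n → Fin d → ℝ | ∀ i ∈ S, dot v (x i) ∉ Set.Icc a (2 * a)}
      = Set.pi Set.univ (fun i => if i ∈ S then Eᶜ else Set.univ) := by
    ext x
    simp only [Set.mem_ofPred_eq, Set.mem_pi, Set.mem_univ, true_imp_iff]
    refine forall_congr' fun i => ?_
    by_cases hi : i ∈ S <;> simp [hi, hE]
  rw [hset]
  unfold sample
  rw [Measure.real, Measure.pi_pi, ENNReal.toReal_prod]
  have : ∀ i : Fin n, (stdGaussian d (if i ∈ S then Eᶜ else Set.univ)).toReal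
      = if i ∈ S then (1 - (stdGaussian d).real E) else 1 := by
    intro i
    split_ifs
    · exact probReal_compl_eq_one_sub hEm
    · simp
  simp_rw [this]
  rw [Finset.prod_ite_mem, Finset.univ_inter, Finset.prod_const, hEp]
  have hl := gauss_lower a ha
  have h1 : (gaussianReal 0 1).real (Set.Icc a (2 * a)) ≤ 1 := measureReal_le_one
  calc _ ≤ (Real.exp (-(1 / 3 * Real.exp (-2 * a ^ 2)))) ^ S.card := by
        apply pow_le_pow_left₀ (by linarith)
        have := Real.add_one_le_exp (-(1 / 3 * Real.exp (-2 * a ^ 2)))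
        linarith
    _ = _ := by rw [← Real.exp_nat_mul]; congr 1; ring

lemma norm_low_i {n d : ℕ} (hd : 0 < d) (i : Fin n) :
    (sample n d).real {x | ∑ j, (x i j) ^ 2 ≤ d / 2} ≤ 4 * mV / d := by
  have hmp := measurePreserving_eval (fun _ : Fin n => stdGaussian d) i
  have hm : MeasurableSet {x : Fin d → ℝ | ∑ j, (x j) ^ 2 ≤ d / 2} :=
    measurableSet_le (by fun_prop) (by fun_prop)
  have := hmp.measureReal_preimage hm.nullMeasurableSet
  exact this.le.trans (norm_low d hd)

lemma mA_nonneg : 0 ≤ mA := integral_nonneg fun z => by positivity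
lemma mB_nonneg : 0 ≤ mB := variance_nonneg _ _
lemma mV_nonneg : 0 ≤ mV := variance_nonneg _ _

lemma det_bound {k d : ℕ} (hd : 0 < d) (wstar : Fin d → ℝ) (x : Fin (k+1) → Fin d → ℝ)
    (i : Fin (k+1)) (l : ℝ) (hl : 0 ≤ l) (hld : l ≤ d)
    (h1 : l / 16 ≤ dot wstar (x i) ^ 2) (h2 : dot wstar (x i) ^ 2 ≤ l / 4)
    (hP : (d : ℝ) / 2 ≤ ∑ j, (x i j) ^ 2)
    (hA : ∑ j, dot wstar (x j) ^ 4 ≤ (mA + 1) * (k + 1 : ℕ))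
    (hB : ∑ j : Fin k, (dot (x i) (x (i.succAbove j))) ^ 4 ≤
      (mA + 1) * k * (∑ j, (x i j) ^ 2) ^ 2) :
    ∃ (u w : Fin d → ℝ), nrm u = 1 ∧ nrm (w - wstar) ≤ Real.sqrt (l / d) ∧
      hessQF wstar w u x ≤ -(1/32) * ((d : ℝ) * l) / (k + 1 : ℕ) + 12 * (mA + 1) := by
  have hd' : (0 : ℝ) < d := by exact_mod_cast hd
  set P := ∑ j, (x i j) ^ 2 with hPdef
  have hP0 : 0 < P := by linarith
  set r := Real.sqrt P with hr
  have hr0 : 0 < r := Real.sqrt_pos.2 hP0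
  have hr2 : r ^ 2 = P := Real.sq_sqrt hP0.le
  set s := dot wstar (x i) / r with hs
  have hs2 : s ^ 2 ≤ l / (2 * d) := by
    rw [hs, div_pow, hr2, div_le_div_iff₀ hP0 (by positivity)]
    nlinarith
  have hs2' : s ^ 2 ≤ 1 := hs2.trans (by rw [div_le_one (by positivity)]; linarith)
  have hdu : ∀ z : Fin d → ℝ, dot (fun j => x i j / r) z = dot (x i) z / r := by
    intro z; unfold dot
    rw [Finset.sum_div]; congr 1; ext j; ring
  have hdw : ∀ z : Fin d → ℝ, dot (fun j => wstar j - s * (x i j / r)) z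
      = dot wstar z - s * (dot (x i) z / r) := by
    intro z; rw [← hdu]; unfold dot
    rw [Finset.mul_sum, ← Finset.sum_sub_distrib]; congr 1; ext j; ring
  have hxx : dot (x i) (x i) = P := by
    unfold dot; rw [hPdef]; congr 1; ext j; ring
  refine ⟨fun j => x i j / r, fun j => wstar j - s * (x i j / r), ?_, ?_, ?_⟩
  · unfold nrm
    simp_rw [div_pow]
    rw [← Finset.sum_div, hr2, div_self (by positivity), Real.sqrt_one]
  · unfold nrm
    apply Real.sqrt_le_sqrt
    have : ∑ j, (((fun j => wstar j - s * (x i j / r)) - wstar) j) ^ 2 = s ^ 2 := by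
      have : ∀ j, (((fun j => wstar j - s * (x i j / r)) - wstar) j) ^ 2
          = s ^ 2 / P * (x i j) ^ 2 := by
        intro j; simp only [Pi.sub_apply]; rw [← hr2]; field_simp; ring
      simp_rw [this]
      rw [← Finset.mul_sum, ← hPdef]; field_simp
    rw [this]
    refine hs2.trans ?_
    apply div_le_div_of_nonneg_left hl hd'; linarith
  · unfold hessQF
    simp_rw [hdu, hdw]
    rw [Fin.sum_univ_succAbove _ i]
    rw [hxx]
    have e1 : dot wstar (x i) - s * (P / r) = 0 := by
      rw [hs, ← hr2]; field_simp; ring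
    have e2 : (P / r) ^ 2 = P := by
      rw [div_pow, hr2]; field_simp
    rw [e1, e2]
    have hterm : ∀ j : Fin k,
        (3 * (dot wstar (x (i.succAbove j)) - s * (dot (x i) (x (i.succAbove j)) / r)) ^ 2
          - dot wstar (x (i.succAbove j)) ^ 2) * (dot (x i) (x (i.succAbove j)) / r) ^ 2
        ≤ 3 * dot wstar (x (i.succAbove j)) ^ 4
          + 9 / P ^ 2 * dot (x i) (x (i.succAbove j)) ^ 4 := by
      intro j
      set α := dot wstar (x (i.succAbove j))
      have : 9 / P ^ 2 * dot (x i) (x (i.succAbove j)) ^ 4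
        = 9 * (dot (x i) (x (i.succAbove j)) / r) ^ 4 := by
        rw [← hr2]; field_simp
      rw [this]
      set b := dot (x i) (x (i.succAbove j)) / r
      have f1 : (α - s * b) ^ 2 ≤ 2 * α ^ 2 + 2 * b ^ 2 := by
        nlinarith [sq_nonneg (α + s * b), mul_le_mul_of_nonneg_right hs2' (sq_nonneg b)]
      have f2 : (3 * (α - s * b) ^ 2 - α ^ 2) * b ^ 2 ≤ (6 * α ^ 2 + 6 * b ^ 2) * b ^ 2 :=
        mul_le_mul_of_nonneg_right (by nlinarith [sq_nonneg α]) (sq_nonneg b)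
      nlinarith [sq_nonneg (α ^ 2 - b ^ 2)]
    have hsum := Finset.sum_le_sum (fun j (_ : j ∈ Finset.univ) => hterm j)
    rw [Finset.sum_add_distrib, ← Finset.mul_sum, ← Finset.mul_sum] at hsum
    have hA' : ∑ j : Fin k, dot wstar (x (i.succAbove j)) ^ 4 ≤ (mA + 1) * (k + 1 : ℕ) := by
      rw [Fin.sum_univ_succAbove _ i] at hA
      have : 0 ≤ dot wstar (x i) ^ 4 := by positivity
      linarith
    have hB' : 9 / P ^ 2 * ∑ j : Fin k, (dot (x i) (x (i.succAbove j))) ^ 4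
        ≤ 9 * ((mA + 1) * k) := by
      calc _ ≤ 9 / P ^ 2 * ((mA + 1) * k * P ^ 2) := by gcongr
        _ = _ := by field_simp
    have hN : (0 : ℝ) < (k + 1 : ℕ) := by positivity
    have hfirst : (3 * (0 : ℝ) ^ 2 - dot wstar (x i) ^ 2) * P ≤ -(1/32) * (d * l) := by
      have : l / 16 * (d / 2) ≤ dot wstar (x i) ^ 2 * P :=
        mul_le_mul h1 hP (by positivity) (by positivity)
      linarith
    rw [div_add' _ _ _ hN.ne', one_div, inv_mul_eq_div]
    apply div_le_div_of_nonneg_right _ hN.le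
    have hk : (k : ℝ) ≤ (k + 1 : ℕ) := by push_cast; linarith
    have := mul_le_mul_of_nonneg_left hk (by linarith [mA_nonneg] : 0 ≤ mA + 1)
    linarith

lemma det_easy {n d : ℕ} (hn : 0 < n) (wstar : Fin d → ℝ) (x : Fin n → Fin d → ℝ)
    (hA : ∑ j, dot wstar (x j) ^ 4 ≤ (mA + 1) * n) :
    hessQF wstar wstar wstar x ≤ 2 * (mA + 1) := by
  have hN : (0 : ℝ) < n := by exact_mod_cast hn
  unfold hessQF
  rw [one_div, inv_mul_eq_div, div_le_iff₀ hN]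
  have : ∀ j, (3 * dot wstar (x j) ^ 2 - dot wstar (x j) ^ 2) * dot wstar (x j) ^ 2
      = 2 * dot wstar (x j) ^ 4 := fun j => by ring
  simp_rw [this]
  rw [← Finset.mul_sum]; linarith

lemma compl_bound {α : Type*} [MeasurableSpace α] (μ : Measure α) [IsProbabilityMeasure μ]
    (T B : Set α) (h : ∀ x, x ∉ B → x ∈ T) (b : ℝ) (hb : μ.real B ≤ b) : 1 - b ≤ μ.real T := by
  have : μ.real Set.univ ≤ μ.real (T ∪ B) := measureReal_mono (fun x _ => by
    by_cases hx : x ∈ B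
    · exact Or.inr hx
    · exact Or.inl (h x hx))
  rw [probReal_univ] at this
  linarith [measureReal_union_le (μ := μ) T B]

lemma my_le_of_sq {a b : ℝ} (h : a ^ 2 ≤ b ^ 2) (hb : 0 ≤ b) : a ≤ b :=
  le_of_abs_le ((sq_le_sq.1 h).trans (abs_of_nonneg hb).le)

lemma core (k d : ℕ) (wstar : Fin d → ℝ) (hw : nrm wstar = 1)
    (hn : Real.exp 16 ≤ ((k + 1 : ℕ) : ℝ)) (hd : 0 < d) :
    1 - (3 * mB + 32 * mV + 6) * Real.exp (-(1/4) * Real.log (k + 1 : ℕ)) ≤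
      (sample (k+1) d).real {x | ∃ (u w : Fin d → ℝ), nrm u = 1 ∧
        nrm (w - wstar) ≤ Real.sqrt (Real.log (k + 1 : ℕ) / d) ∧
        hessQF wstar w u x ≤ -(1/32) * ((d : ℝ) * Real.log (k + 1 : ℕ)) / (k + 1 : ℕ)
          + (12 * (mA + 1) + 1)} := by
  set N : ℝ := ((k + 1 : ℕ) : ℝ) with hNdef
  have hd' : (0 : ℝ) < d := by exact_mod_cast hd
  have hN0 : 0 < N := lt_of_lt_of_le (Real.exp_pos _) hn
  have hl16 : 16 ≤ Real.log N := (Real.le_log_iff_exp_le hN0).2 hn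
  set l := Real.log N with hldef
  set y := Real.exp (l / 8) with hy
  have hy1 : 1 ≤ y := Real.one_le_exp (by linarith)
  have hy0 : 0 < y := by linarith
  have hNy : N = y ^ 8 := by
    rw [hy, ← Real.exp_nat_mul, ← Real.exp_log hN0]; congr 1; push_cast; ring
  have hly : l ≤ 8 * y := by
    have := Real.add_one_le_exp (l / 8); rw [← hy] at this; linarith
  have hq : Real.exp (-(1/4) * l) = 1 / y ^ 2 := by
    rw [hy, ← Real.exp_nat_mul, one_div (Real.exp _), ← Real.exp_neg]; congr 1; push_cast; ring
  have hk17 : 17 ≤ N := by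
    have := Real.add_one_le_exp (16 : ℝ); linarith
  have hkN : (k : ℝ) = N - 1 := by rw [hNdef]; push_cast; ring
  have hk0 : 0 < k := by
    have : (0 : ℝ) < k := by linarith
    exact_mod_cast this
  have hmB := mB_nonneg
  have hmV := mV_nonneg
  have hmA := mA_nonneg
  set B1 : Set (Fin (k+1) → Fin d → ℝ) := {x | (mA + 1) * (k + 1 : ℕ) ≤ ∑ j, (dot wstar (x j)) ^ 4}
  have hB1 : (sample (k+1) d).real B1 ≤ mB / N := fourth hw (k+1) (by omega)
  have hB1' : mB / N ≤ mB / y ^ 2 := by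
    apply div_le_div_of_nonneg_left hmB (by positivity)
    rw [hNy]; exact pow_le_pow_right₀ hy1 (by norm_num)
  rw [hq]
  by_cases hcase : d * l ≤ N
  · apply compl_bound _ _ B1
    · intro x hx
      refine ⟨wstar, wstar, hw, ?_, ?_⟩
      · have : nrm (wstar - wstar) = 0 := by simp [nrm]
        rw [this]; exact Real.sqrt_nonneg _
      · have h := det_easy (by omega) wstar x (le_of_lt (not_le.1 hx))
        have : d * l / N ≤ 1 := (div_le_one hN0).2 hcase
        rw [mul_div_assoc]
        linarith
    · refine (hB1.trans hB1').trans ?_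
      rw [mul_one_div]
      apply div_le_div_of_nonneg_right _ (by positivity)
      linarith
  · push Not at hcase
    have hld : l ≤ d := by
      have h1 : l ^ 2 ≤ N := by
        have := Real.quadratic_le_exp_of_nonneg (x := l / 2) (by linarith)
        have h3 : N = Real.exp (l / 2) ^ 2 := by
          rw [← Real.exp_nat_mul, ← Real.exp_log hN0]; congr 1; push_cast; ring
        rw [h3]
        apply pow_le_pow_left₀ (by linarith)
        nlinarith
      nlinarith
    set m := Nat.sqrt (k+1) with hm
    have hm1 : (m : ℝ) ≤ y ^ 4 := by
      have : ((m * m : ℕ) : ℝ) ≤ N := by rw [hNdef]; exact_mod_cast Nat.sqrt_le (k+1)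
      push_cast at this
      apply my_le_of_sq _ (by positivity)
      nlinarith
    have hm2 : y ^ 4 / 2 ≤ m := by
      have : N < (((m+1) * (m+1) : ℕ) : ℝ) := by
        rw [hNdef]; exact_mod_cast Nat.lt_succ_sqrt (k+1)
      push_cast at this
      have h4 : y ^ 4 < m + 1 := by
        apply lt_of_pow_lt_pow_left₀ 2 (by positivity)
        nlinarith
      have : 2 ≤ y ^ 4 := by
        have : (2 : ℝ) ^ 2 ≤ (y ^ 4) ^ 2 := by nlinarith
        exact my_le_of_sq this (by positivity)
      linarith
    obtain ⟨S, -, hS⟩ := Finset.exists_subset_card_eq (s := (Finset.univ : Finset (Fin (k+1))))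
      (n := m) (by simpa using Nat.sqrt_le_self (k+1))
    set a := Real.sqrt l / 4 with ha
    have ha2 : a ^ 2 = l / 16 := by
      rw [ha, div_pow, Real.sq_sqrt (by linarith)]; norm_num
    have ha1 : 1 ≤ a := by
      have : (1 : ℝ) ^ 2 ≤ a ^ 2 := by rw [ha2]; linarith
      exact my_le_of_sq this (by positivity)
    set B2 : Fin (k+1) → Set (Fin (k+1) → Fin d → ℝ) := fun i => {x | ∑ j, (x i j) ^ 2 ≤ d / 2}
    set B3 : Fin (k+1) → Set (Fin (k+1) → Fin d → ℝ) := fun i => {x | 0 < ∑ j, (x i j) ^ 2 ∧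
      (mA + 1) * k * (∑ j, (x i j) ^ 2) ^ 2 ≤ ∑ j : Fin k, (dot (x i) (x (i.succAbove j))) ^ 4}
    set B4 : Set (Fin (k+1) → Fin d → ℝ) := {x | ∀ i ∈ S, dot wstar (x i) ∉ Set.Icc a (2 * a)}
    have hB2 : (sample (k+1) d).real (⋃ i ∈ S, B2 i) ≤ 32 * mV / y ^ 2 := by
      refine (measureReal_biUnion_finset_le _ _).trans ?_
      refine (Finset.sum_le_sum (fun i _ => norm_low_i hd i)).trans ?_
      rw [Finset.sum_const, hS, nsmul_eq_mul]
      have h1 : 1 / (d : ℝ) ≤ l / N := by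
        rw [div_le_div_iff₀ hd' hN0]; linarith
      calc (m : ℝ) * (4 * mV / d) = m * (4 * mV) * (1 / d) := by ring
        _ ≤ y ^ 4 * (4 * mV) * (8 * y / y ^ 8) := by
            refine mul_le_mul (by gcongr) (h1.trans ?_) (by positivity) (by positivity)
            rw [hNy]; gcongr
        _ = 32 * mV / y ^ 3 := by field_simp; ring
        _ ≤ _ := by
            apply div_le_div_of_nonneg_left (by positivity) (by positivity)
            exact pow_le_pow_right₀ hy1 (by norm_num)
    have hB3 : (sample (k+1) d).real (⋃ i ∈ S, B3 i) ≤ 2 * mB / y ^ 2 := by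
      refine (measureReal_biUnion_finset_le _ _).trans ?_
      refine (Finset.sum_le_sum (fun i _ => slice_bound hk0 hd i)).trans ?_
      rw [Finset.sum_const, hS, nsmul_eq_mul]
      calc (m : ℝ) * (mB / k) ≤ y ^ 4 * (mB / (y ^ 8 / 2)) := by
            gcongr; rw [← hNy]; linarith
        _ = 2 * mB / y ^ 4 := by field_simp
        _ ≤ _ := by
            apply div_le_div_of_nonneg_left (by positivity) (by positivity)
            exact pow_le_pow_right₀ hy1 (by norm_num)
    have hB4 : (sample (k+1) d).real B4 ≤ 6 / y ^ 2 := by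
      refine (none_bound hw S a ha1).trans ?_
      have h1 : Real.exp (-2 * a ^ 2) = 1 / y := by
        rw [ha2, hy, one_div, ← Real.exp_neg]; congr 1; ring
      rw [h1, hS]
      have h2 : y ^ 3 / 6 ≤ 1 / 3 * (1 / y) * m := by
        calc y ^ 3 / 6 = 1 / 3 * (1 / y) * (y ^ 4 / 2) := by field_simp; ring
          _ ≤ _ := by gcongr
      calc Real.exp (-(1 / 3 * (1 / y) * m)) ≤ Real.exp (-(y ^ 3 / 6)) :=
            Real.exp_le_exp.2 (by linarith)
        _ ≤ (y ^ 3 / 6)⁻¹ := by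
            rw [Real.exp_neg]
            apply inv_anti₀ (by positivity)
            linarith [Real.add_one_le_exp (y ^ 3 / 6)]
        _ = 6 / y ^ 3 := by field_simp
        _ ≤ _ := by
            apply div_le_div_of_nonneg_left (by positivity) (by positivity)
            exact pow_le_pow_right₀ hy1 (by norm_num)
    apply compl_bound _ _ (B1 ∪ ((⋃ i ∈ S, B2 i) ∪ ((⋃ i ∈ S, B3 i) ∪ B4)))
    · intro x hx
      simp only [Set.mem_union, not_or, Set.mem_iUnion, not_exists] at hx
      obtain ⟨hx1, hx2, hx3, hx4⟩ := hx
      have hx4' : ∃ i ∈ S, dot wstar (x i) ∈ Set.Icc a (2 * a) := by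
        by_contra hcon
        push Not at hcon
        exact hx4 hcon
      obtain ⟨i, hi, hia⟩ := hx4'
      have hP : (d : ℝ) / 2 ≤ ∑ j, (x i j) ^ 2 := le_of_lt (not_le.1 (hx2 i hi))
      have hP0 : 0 < ∑ j, (x i j) ^ 2 := by linarith
      have hB : ∑ j : Fin k, (dot (x i) (x (i.succAbove j))) ^ 4 ≤
          (mA + 1) * k * (∑ j, (x i j) ^ 2) ^ 2 :=
        le_of_lt (not_le.1 fun hcon => hx3 i hi ⟨hP0, hcon⟩)
      have ha0 : 0 ≤ a := by linarith
      obtain ⟨u, w, hu, hww, hh⟩ := det_bound hd wstar x i l (by linarith) hld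
        (by rw [← ha2]; exact pow_le_pow_left₀ ha0 hia.1 2)
        (by have := pow_le_pow_left₀ (ha0.trans hia.1) hia.2 2
            rw [mul_pow, ha2] at this; linarith) hP (le_of_lt (not_le.1 hx1)) hB
      exact ⟨u, w, hu, hww, hh.trans (by linarith)⟩
    · have e : (3 * mB + 32 * mV + 6) * (1 / y ^ 2)
        = mB / y ^ 2 + (32 * mV / y ^ 2 + (2 * mB / y ^ 2 + 6 / y ^ 2)) := by ring
      rw [e]
      refine (measureReal_union_le _ _).trans (add_le_add (hB1.trans hB1') ?_)
      refine (measureReal_union_le _ _).trans (add_le_add hB2 ?_)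
      exact (measureReal_union_le _ _).trans (add_le_add hB3 hB4)

/-- **Theorem 2.3**: there are absolute constants `C, c > 0` such that for `n, d ≥ C`,
with `γ_{n,d} = C √(log n / d)`, with probability at least `1 - C e^{-c √d} - C e^{-c log n}`,
`min_{u ∈ S^{d-1}, ‖w - w*‖ ≤ γ_{n,d}} u^⊤ ∇²L(w) u ≤ -c (d log n)/n + C`. -/
theorem stmt2 :
    ∃ C > (0 : ℝ), ∃ c > (0 : ℝ),
      ∀ (n d : ℕ) (wstar : Fin d → ℝ),
        nrm wstar = 1 → C ≤ (n : ℝ) → C ≤ (d : ℝ) →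
        1 - C * Real.exp (-c * Real.sqrt d) - C * Real.exp (-c * Real.log n) ≤
          (sample n d {x | ∃ (u w : Fin d → ℝ), nrm u = 1 ∧
              nrm (w - wstar) ≤ C * Real.sqrt (Real.log n / d) ∧
              hessQF wstar w u x ≤ -c * ((d : ℝ) * Real.log n) / n + C}).toReal := by
  have hmB := mB_nonneg
  have hmV := mV_nonneg
  have hmA := mA_nonneg
  have he := Real.exp_pos 16
  have he1 : 1 ≤ Real.exp 16 := Real.one_le_exp (by norm_num)
  refine ⟨3 * mB + 32 * mV + 6 + (12 * (mA + 1) + 1) + Real.exp 16, by positivity, 1/32,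
    by norm_num, ?_⟩
  set C := 3 * mB + 32 * mV + 6 + (12 * (mA + 1) + 1) + Real.exp 16 with hC
  intro n d wstar hw hn hd
  have hC0 : 1 ≤ C := by linarith
  have hn0 : 0 < n := by
    have : (0 : ℝ) < n := by linarith
    exact_mod_cast this
  have hd0 : 0 < d := by
    have : (0 : ℝ) < d := by linarith
    exact_mod_cast this
  obtain ⟨k, rfl⟩ : ∃ k, n = k + 1 := ⟨n - 1, by omega⟩
  have hcore := core k d wstar hw (by linarith) hd0
  have hlog : 0 ≤ Real.log ((k + 1 : ℕ) : ℝ) := Real.log_nonneg (by linarith)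
  have h1 : (3 * mB + 32 * mV + 6) * Real.exp (-(1/4) * Real.log (k + 1 : ℕ))
      ≤ C * Real.exp (-(1/32) * Real.log (k + 1 : ℕ)) := by
    apply mul_le_mul (by linarith) _ (by positivity) (by linarith)
    apply Real.exp_le_exp.2; linarith
  have h2 : 0 ≤ C * Real.exp (-(1/32) * Real.sqrt d) := by positivity
  refine le_trans (by linarith) (hcore.trans ?_)
  refine measureReal_mono (μ := sample (k+1) d) ?_ (measure_ne_top _ _)
  rintro x ⟨u, w, hu, hww, hh⟩
  refine ⟨u, w, hu, hww.trans ?_, hh.trans (by linarith)⟩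
  exact le_mul_of_one_le_left (Real.sqrt_nonneg _) hC0
end
end
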